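/- arXiv:0711.4459 — 2 statements merged into one kernel-verified Lean document; each statement's English description precedes it below -/
import Mathlib

section
/- Let F be a finite field with |F| = 7 and let n > 2. Then every 2-subgroup P of GL_n(F) contains fewer than 7^{n-1} + 7^{n-2} + ⋯ + 7 + 1 involutions. -/
/-- If `H` embeds in `G` with odd index, then a `2`-subgroup of `G` has no more solutions of
`x ^ 2 = 1` than some `2`-subgroup of `H`. -/
theorem card_sq_eq_one_le_of_odd_index {G H : Type*} [Group G] [Finite G] [Group H]
    (f : H →* G) (hf : Function.Injective f) (hidx : ¬ 2 ∣ f.range.index) {N : ℕ}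
    (hH : ∀ Q : Subgroup H, IsPGroup 2 Q → Nat.card {x : H | x ∈ Q ∧ x ^ 2 = 1} ≤ N)
    (P : Subgroup G) (hP : IsPGroup 2 P) :
    Nat.card {x : G | x ∈ P ∧ x ^ 2 = 1} ≤ N := by
  have : Finite H := Finite.of_injective f hf
  have : Fact (Nat.Prime 2) := ⟨Nat.prime_two⟩
  obtain ⟨q, hq⟩ := hP.nonempty_fixed_point_of_prime_not_dvd_card (G ⧸ f.range) hidx
  obtain ⟨g, rfl⟩ := QuotientGroup.mk_surjective q
  have hconj : ∀ p ∈ P, ∃ h, f h = g⁻¹ * p * g := by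
    intro p hp
    have h1 : ((g : G) : G ⧸ f.range) = ((p * g : G) : G ⧸ f.range) := (hq ⟨p, hp⟩).symm
    rw [QuotientGroup.eq] at h1
    simpa [mul_assoc] using h1
  let Q : Subgroup H := (P.map (MulAut.conj g⁻¹).toMonoidHom).comap f
  have hQ : IsPGroup 2 Q := (hP.map _).comap_of_injective f hf
  refine le_trans ?_ (hH Q hQ)
  have key : ∀ x : {x : G | x ∈ P ∧ x ^ 2 = 1},
      ∃ y : {x : H | x ∈ Q ∧ x ^ 2 = 1}, f y = g⁻¹ * x * g := by
    rintro ⟨x, hx, hx2⟩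
    obtain ⟨h, hh⟩ := hconj x hx
    refine ⟨⟨h, ⟨x, hx, by simp [hh]⟩, hf ?_⟩, hh⟩
    rw [map_pow, hh, map_one]
    simpa [hx2] using conj_pow (i := 2) (a := g⁻¹) (b := x)
  choose F hF using key
  refine Nat.card_le_card_of_injective F fun x y hxy => Subtype.ext ?_
  have h2 := hF x
  rw [hxy, hF y] at h2
  simpa using h2.symm

/-- Solutions of `x ^ 2 = 1` in a subgroup of `G × D` are at most `|D|` times as numerous as in its
projection to `G`. -/
theorem card_sq_eq_one_prod_le {G D : Type*} [Group G] [Finite G] [Group D] [Finite D]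
    (Q : Subgroup (G × D)) :
    Nat.card {x : G × D | x ∈ Q ∧ x ^ 2 = 1} ≤
      Nat.card {x : G | x ∈ Q.map (MonoidHom.fst G D) ∧ x ^ 2 = 1} * Nat.card D := by
  rw [← Nat.card_prod]
  refine Nat.card_le_card_of_injective
    (fun x => (⟨x.1.1, ⟨x.1, x.2.1, rfl⟩, congrArg Prod.fst x.2.2⟩, x.1.2)) fun x y hxy => ?_
  simp only [Prod.mk.injEq, Subtype.mk.injEq] at hxy
  exact Subtype.ext (Prod.ext hxy.1 hxy.2)

/-- A `2`-group of permutations of `m` points has order at most `2 ^ (m - 1)`. -/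
theorem card_two_subgroup_perm_le {m : ℕ} (hm : m ≠ 0) (Q : Subgroup (Equiv.Perm (Fin m)))
    (hQ : IsPGroup 2 Q) : Nat.card Q ≤ 2 ^ (m - 1) := by
  have : Fact (Nat.Prime 2) := ⟨Nat.prime_two⟩
  obtain ⟨k, hk⟩ := IsPGroup.iff_card.mp hQ
  have h1 : 2 ^ k ∣ m.factorial := by
    simpa [hk, Fintype.card_perm] using Subgroup.card_subgroup_dvd_card Q
  rw [padicValNat_dvd_iff_le m.factorial_ne_zero] at h1
  have h2 := sub_one_mul_padicValNat_factorial_lt_of_ne_zero 2 hm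
  rw [hk]
  exact Nat.pow_le_pow_right two_pos (by lia)

/-- If `σ` is an involution, a group `S` with `|S| ≤ k ^ 2` and at most `k` solutions of `s ^ 2 = 1`
admits at most `k ^ m` families `a` with `a i * a (σ i) = 1` for all `i`. -/
theorem card_mul_perm_eq_one_le {S : Type*} [Group S] [Finite S] {k m : ℕ}
    (hS : Nat.card S ≤ k ^ 2) (hS2 : Nat.card {s : S | s ^ 2 = 1} ≤ k)
    (σ : Equiv.Perm (Fin m)) (hσ : ∀ i, σ (σ i) = i) :
    Nat.card {a : Fin m → S | ∀ i, a i * a (σ i) = 1} ≤ k ^ m := by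
  let X : Fin m → Set S := fun i =>
    if i < σ i then Set.univ else if σ i = i then {s | s ^ 2 = 1} else {1}
  have hX : ∀ i, Nat.card (X i) * Nat.card (X (σ i)) ≤ k ^ 2 := by
    intro i
    rcases lt_trichotomy i (σ i) with h | h | h
    · simpa [X, hσ, h, h.not_gt, h.ne] using hS
    · rw [← h, sq]
      simpa [X, ← h] using Nat.mul_le_mul hS2 hS2
    · simpa [X, hσ, h, h.not_gt, h.ne] using hS
  have hprod : ∏ i, Nat.card (X i) ≤ k ^ m := by
    refine (Nat.pow_le_pow_iff_left two_ne_zero).mp ?_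
    calc (∏ i, Nat.card (X i)) ^ 2 = ∏ i, Nat.card (X i) * Nat.card (X (σ i)) := by
          rw [Finset.prod_mul_distrib, Equiv.prod_comp σ fun i => Nat.card (X i), sq]
      _ ≤ ∏ _i : Fin m, k ^ 2 := Finset.prod_le_prod' fun i _ => hX i
      _ = (k ^ m) ^ 2 := by simp [← pow_mul, mul_comm]
  refine le_trans ?_ hprod
  rw [← Nat.card_pi]
  have hmem : ∀ (a : {a : Fin m → S | ∀ i, a i * a (σ i) = 1}) (i : Fin m),
      (if σ i < i then 1 else a.1 i) ∈ X i := by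
    rintro ⟨a, ha⟩ i
    rcases lt_trichotomy i (σ i) with h | h | h
    · simp [X, h]
    · have := ha i
      rw [← h] at this
      simp [X, ← h, sq, this]
    · simp [X, h, h.not_gt, h.ne]
  refine Nat.card_le_card_of_injective (fun a i => ⟨_, hmem a i⟩) fun a b hab => ?_
  have hi : ∀ i, ¬ σ i < i → a.1 i = b.1 i := by
    intro i h
    have := congrArg Subtype.val (congrFun hab i)
    simpa [h] using this
  refine Subtype.ext (funext fun i => ?_)
  by_cases h : σ i < i
  · have h2 := hi (σ i) (by rw [hσ]; exact h.not_gt)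
    have ha := a.2 i
    have hb := b.2 i
    rw [h2] at ha
    exact mul_right_cancel (ha.trans hb.symm)
  · exact hi i h

/-- The wreath product of `S` with the symmetric group on `m` letters. -/
abbrev PermWreath (S : Type*) [Group S] (m : ℕ) : Type _ :=
  (Fin m → S) ⋊[mulAutArrow] Equiv.Perm (Fin m)

theorem card_permWreath (S : Type*) [Group S] (m : ℕ) :
    Nat.card (PermWreath S m) = Nat.card S ^ m * m.factorial := by
  rw [SemidirectProduct.card, Nat.card_perm, Nat.card_pi]
  simp

instance (S : Type*) [Group S] [Finite S] (m : ℕ) : Finite (PermWreath S m) :=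
  Finite.of_equiv _ SemidirectProduct.equivProd.symm

theorem card_sq_eq_one_permWreath_le {S : Type*} [Group S] [Finite S] {k m : ℕ}
    (hS : Nat.card S ≤ k ^ 2) (hS2 : Nat.card {s : S | s ^ 2 = 1} ≤ k) (hm : m ≠ 0)
    (Q : Subgroup (PermWreath S m)) (hQ : IsPGroup 2 Q) :
    Nat.card {x : PermWreath S m | x ∈ Q ∧ x ^ 2 = 1} ≤ 2 ^ (m - 1) * k ^ m := by
  let R := Q.map (SemidirectProduct.rightHom : PermWreath S m →* Equiv.Perm (Fin m))
  have := Fintype.ofFinite R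
  let A : Equiv.Perm (Fin m) → Set (Fin m → S) := fun σ =>
    {a | (∀ i, σ (σ i) = i) ∧ ∀ i, a i * a (σ i) = 1}
  have hA : ∀ σ, Nat.card (A σ) ≤ k ^ m := by
    intro σ
    by_cases hσ : ∀ i, σ (σ i) = i
    · simpa [A, hσ] using card_mul_perm_eq_one_le hS hS2 σ hσ
    · simp [A, hσ]
  have h1 : ∀ x : {x : PermWreath S m | x ∈ Q ∧ x ^ 2 = 1}, x.1.left ∈ A x.1.right := by
    rintro ⟨x, -, hx⟩
    rw [sq] at hx
    have hr : x.right * x.right = 1 := congrArg SemidirectProduct.right hx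
    have hσ : ∀ i, x.right (x.right i) = i := fun i => congrArg (fun τ : Equiv.Perm _ => τ i) hr
    refine ⟨hσ, fun i => ?_⟩
    have hl := congrFun (congrArg SemidirectProduct.left hx) i
    have hinv : x.right⁻¹ = x.right := inv_eq_of_mul_eq_one_right hr
    have : x.left i * x.left (x.right⁻¹ i) = 1 := hl
    rwa [hinv] at this
  calc Nat.card {x : PermWreath S m | x ∈ Q ∧ x ^ 2 = 1} ≤ Nat.card (Σ σ : R, A σ) := by
        refine Nat.card_le_card_of_injective
          (fun x => ⟨⟨x.1.right, ⟨x.1, x.2.1, rfl⟩⟩, ⟨x.1.left, h1 x⟩⟩) ?_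
        rintro ⟨⟨a, σ⟩, hx⟩ ⟨⟨b, τ⟩, hy⟩ hxy
        obtain ⟨h1, h2⟩ := Sigma.mk.inj hxy
        obtain rfl : σ = τ := congrArg Subtype.val h1
        obtain rfl : a = b := congrArg Subtype.val (eq_of_heq h2)
        rfl
    _ = ∑ σ : R, Nat.card (A σ) := Nat.card_sigma
    _ ≤ ∑ σ : R, k ^ m := Finset.sum_le_sum fun σ _ => hA σ
    _ = Nat.card R * k ^ m := by simp
    _ ≤ 2 ^ (m - 1) * k ^ m := Nat.mul_le_mul_right _ (card_two_subgroup_perm_le hm R (hQ.map _))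

/-- The group of `2 × 2` matrices `g` over `𝔽₇` with `g gᵀ = ± 1`; it is semidihedral of order `32`,
hence a Sylow `2`-subgroup of `GL₂(𝔽₇)`. -/
def signedOrthogonal : Subgroup (GL (Fin 2) (ZMod 7)) where
  carrier := {g | g.1 * g.1.transpose = 1 ∨ g.1 * g.1.transpose = -1}
  one_mem' := by simp
  mul_mem' := by
    intro a b ha hb
    have h : (a * b).1 * (a * b).1.transpose = a.1 * (b.1 * b.1.transpose) * a.1.transpose := by
      simp [Matrix.transpose_mul, mul_assoc]
    rw [Set.mem_ofPred_eq, h]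
    rcases ha with ha | ha <;> rcases hb with hb | hb <;> simp [ha, hb]
  inv_mem' := by
    intro a ha
    have h1 : a⁻¹.1 * a.1 = 1 := a.inv_mul
    have h2 : a.1.transpose * a⁻¹.1.transpose = 1 := by
      rw [← Matrix.transpose_mul, h1, Matrix.transpose_one]
    have h : a⁻¹.1 * (a.1 * a.1.transpose) * a⁻¹.1.transpose = 1 := by
      rw [← mul_assoc, h1, one_mul, h2]
    rcases ha with ha | ha <;> rw [ha] at h
    · left; simpa using h
    · right; rw [← h]; simp

/-- The quadruples of entries of the elements of `signedOrthogonal`. -/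
abbrev SignedOrthogonalEntries : Type :=
  {p : ZMod 7 × ZMod 7 × ZMod 7 × ZMod 7 // p.1 * p.2.2.1 + p.2.1 * p.2.2.2 = 0 ∧
    p.1 ^ 2 + p.2.1 ^ 2 = p.2.2.1 ^ 2 + p.2.2.2 ^ 2 ∧
    (p.1 ^ 2 + p.2.1 ^ 2 = 1 ∨ p.1 ^ 2 + p.2.1 ^ 2 = -1)}

/-- Elements of `signedOrthogonal` correspond to quadruples of matrix entries. -/
noncomputable def signedOrthogonalEquiv : signedOrthogonal ≃ SignedOrthogonalEntries := by
  refine Equiv.ofBijective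
    (fun g => ⟨(g.1.1 0 0, g.1.1 0 1, g.1.1 1 0, g.1.1 1 1), ?_⟩) ⟨?_, ?_⟩
  · rcases g with ⟨g, hg | hg⟩
    all_goals
      have h00 := congrFun (congrFun hg 0) 0
      have h01 := congrFun (congrFun hg 0) 1
      have h11 := congrFun (congrFun hg 1) 1
      simp [Matrix.mul_apply, Fin.sum_univ_two] at h00 h01 h11
      simp only [sq]
      simp [h00, h01, h11]
  · intro g h hgh
    simp only [Subtype.mk.injEq, Prod.mk.injEq] at hgh
    refine Subtype.ext (Units.ext ?_)
    ext i j
    fin_cases i <;> fin_cases j <;> simp [hgh]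
  · rintro ⟨⟨a, b, c, d⟩, h1, h2, h3⟩
    simp only at h1 h2 h3
    have key : ∀ e : ZMod 7, a ^ 2 + b ^ 2 = e →
        !![a, b; c, d] * (!![a, b; c, d]).transpose = e • 1 := by
      rintro e rfl
      ext i j
      fin_cases i <;> fin_cases j <;> simp [Matrix.mul_apply, Fin.sum_univ_two]
      · ring
      · exact h1
      · rw [← h1]; ring
      · rw [h2]; ring
    rcases h3 with h3 | h3
    · have h := key _ h3
      rw [one_smul] at h
      exact ⟨⟨⟨_, _, h, mul_eq_one_comm.mp h⟩, Or.inl h⟩, rfl⟩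
    · have h := key _ h3
      have h' : !![a, b; c, d] * -(!![a, b; c, d]).transpose = 1 := by rw [mul_neg, h]; simp
      exact ⟨⟨⟨_, _, h', mul_eq_one_comm.mp h'⟩, Or.inr (by rw [h]; simp)⟩, rfl⟩

theorem card_signedOrthogonal : Nat.card signedOrthogonal = 32 := by
  rw [Nat.card_congr signedOrthogonalEquiv, Nat.card_eq_fintype_card]
  decide +kernel

theorem card_sq_eq_one_signedOrthogonal_le : Nat.card {s : signedOrthogonal | s ^ 2 = 1} ≤ 10 := by
  let T := {p : SignedOrthogonalEntries // p.1.1 * p.1.1 + p.1.2.1 * p.1.2.2.1 = 1 ∧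
    p.1.1 * p.1.2.1 + p.1.2.1 * p.1.2.2.2 = 0 ∧ p.1.2.2.1 * p.1.1 + p.1.2.2.2 * p.1.2.2.1 = 0 ∧
    p.1.2.2.1 * p.1.2.1 + p.1.2.2.2 * p.1.2.2.2 = 1}
  have hmem : ∀ s : {s : signedOrthogonal | s ^ 2 = 1},
      ∃ t : T, t.1 = signedOrthogonalEquiv s := by
    rintro ⟨s, hs⟩
    have h : s.1.1 * s.1.1 = 1 := by
      rw [← sq]; exact congrArg (fun t : signedOrthogonal => t.1.1) hs
    have h00 := congrFun (congrFun h 0) 0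
    have h01 := congrFun (congrFun h 0) 1
    have h10 := congrFun (congrFun h 1) 0
    have h11 := congrFun (congrFun h 1) 1
    simp only [Matrix.mul_apply, Fin.sum_univ_two] at h00 h01 h10 h11
    exact ⟨⟨signedOrthogonalEquiv s, h00, h01, h10, h11⟩, rfl⟩
  choose f hf using hmem
  have hinj : Function.Injective f := fun s t hst =>
    Subtype.ext (signedOrthogonalEquiv.injective (by rw [← hf, ← hf, hst]))
  refine (Nat.card_le_card_of_injective f hinj).trans ?_
  rw [Nat.card_eq_fintype_card]
  decide +kernel

/-- The representation of the wreath product `S ≀ Sₘ` on `Uᵐ` induced by a representation of `S` on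
`U`. -/
def PermWreath.rep {K U S : Type*} [CommRing K] [AddCommGroup U] [Module K U] [Group S]
    (ρ : S →* Module.End K U) (m : ℕ) : PermWreath S m →* Module.End K (Fin m → U) where
  toFun x := LinearMap.pi fun i => (ρ (x.left i)).comp (LinearMap.proj (x.right⁻¹ i))
  map_one' := by
    ext
    simp
  map_mul' x y := by
    refine LinearMap.ext fun v => funext fun i => ?_
    change ρ (x.left i * y.left (x.right⁻¹ i)) (v ((x.right * y.right)⁻¹ i)) = _
    simp

theorem PermWreath.rep_apply {K U S : Type*} [CommRing K] [AddCommGroup U] [Module K U] [Group S]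
    (ρ : S →* Module.End K U) (m : ℕ) (x : PermWreath S m) (v : Fin m → U) (i : Fin m) :
    PermWreath.rep ρ m x v i = ρ (x.left i) (v (x.right⁻¹ i)) := rfl

theorem PermWreath.rep_injective {K U S : Type*} [CommRing K] [AddCommGroup U] [Module K U]
    [Nontrivial U] [Group S] {ρ : S →* Module.End K U} (hρ : Function.Injective ρ) (m : ℕ) :
    Function.Injective (PermWreath.rep ρ m) := by
  rw [injective_iff_map_eq_one]
  intro x hx
  have hv : ∀ (v : Fin m → U) (i : Fin m), ρ (x.left i) (v (x.right⁻¹ i)) = v i := fun v i => by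
    rw [← PermWreath.rep_apply, hx]; rfl
  have hr : x.right⁻¹ = 1 := by
    refine Equiv.ext fun i => ?_
    by_contra hi
    rw [Equiv.Perm.one_apply] at hi
    obtain ⟨u, hu⟩ := exists_ne (0 : U)
    have := hv (Pi.single i u) i
    rw [Pi.single_eq_same, Pi.single_eq_of_ne hi, map_zero] at this
    exact hu this.symm
  refine SemidirectProduct.ext (funext fun i => hρ (LinearMap.ext fun u => ?_)) (inv_eq_one.mp hr)
  simpa [hr] using hv (fun _ => u) i

/-- Diagonal sign matrices acting on `Kᵉ`. -/
def signRep (K : Type*) [CommRing K] (e : ℕ) : (Fin e → ℤˣ) →* Module.End K (Fin e → K) where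
  toFun d := LinearMap.pi fun i => ((d i : ℤ) : K) • LinearMap.proj i
  map_one' := by ext; simp
  map_mul' c d := by
    refine LinearMap.ext fun v => funext fun i => ?_
    simp [mul_assoc]

theorem signRep_injective (K : Type*) [CommRing K] [NeZero (2 : K)] (e : ℕ) :
    Function.Injective (signRep K e) := by
  rw [injective_iff_map_eq_one]
  intro d hd
  funext i
  have h : ((d i : ℤ) : K) * 1 = 1 := congrFun (LinearMap.congr_fun hd fun _ => 1) i
  rcases Int.units_eq_one_or (d i) with hi | hi
  · exact hi
  · rw [hi] at h
    refine absurd ?_ (two_ne_zero (α := K))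
    push_cast at h
    linear_combination -h

/-- The direct product of `S ≀ Sₘ`, where `S` is a Sylow `2`-subgroup of `GL₂(𝔽₇)`, with
`{±1}ᵉ`. -/
abbrev BlockMonomial (m e : ℕ) : Type := PermWreath signedOrthogonal m × (Fin e → ℤˣ)

theorem card_blockMonomial (m e : ℕ) :
    Nat.card (BlockMonomial m e) = 32 ^ m * m.factorial * 2 ^ e := by
  rw [Nat.card_prod, card_permWreath, card_signedOrthogonal]
  simp

theorem exists_blockMonomial_embedding (F : Type*) [Field F] [Fintype F]
    (hF : Fintype.card F = 7) (m e : ℕ) :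
    ∃ f : BlockMonomial m e →* GL (Fin (2 * m + e)) F, Function.Injective f := by
  have : NeZero (2 : ZMod 7) := ⟨by decide⟩
  have : Fact (Nat.Prime 7) := ⟨by norm_num⟩
  let ρ : signedOrthogonal →* Module.End (ZMod 7) (Fin 2 → ZMod 7) :=
    (Matrix.toLinAlgEquiv' (R := ZMod 7) (n := Fin 2) : _ →* _).comp
      ((Units.coeHom _).comp signedOrthogonal.subtype)
  have hρ : Function.Injective ρ :=
    (Matrix.toLinAlgEquiv' (R := ZMod 7) (n := Fin 2)).injective.comp
      (Units.val_injective.comp Subtype.val_injective)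
  let V := (Fin m → Fin 2 → ZMod 7) × (Fin e → ZMod 7)
  have hV : Module.finrank (ZMod 7) V = 2 * m + e := by
    simp [V, Module.finrank_pi_fintype, mul_comm]
  let τ := (LinearMap.toMatrixAlgEquiv (Module.finBasisOfFinrankEq (ZMod 7) V hV)).toRingEquiv.trans
    (ZMod.ringEquivOfPrime F (by norm_num) hF).mapMatrix
  let g : BlockMonomial m e →* Module.End (ZMod 7) V :=
    (LinearMap.prodMapAlgHom (ZMod 7) (Fin m → Fin 2 → ZMod 7) (Fin e → ZMod 7)).toMonoidHom.comp
      ((PermWreath.rep ρ m).prodMap (signRep (ZMod 7) e))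
  have hg : Function.Injective g := by
    have h := (PermWreath.rep_injective hρ m).prodMap (signRep_injective (ZMod 7) e)
    refine Function.Injective.comp (g := fun p : Module.End (ZMod 7) _ × Module.End (ZMod 7) _ =>
      LinearMap.prodMap p.1 p.2) ?_ h
    rintro ⟨a, b⟩ ⟨c, d⟩ hab
    refine Prod.ext (LinearMap.ext fun v => ?_) (LinearMap.ext fun v => ?_)
    · exact congrArg Prod.fst (LinearMap.congr_fun hab (v, 0))
    · exact congrArg Prod.snd (LinearMap.congr_fun hab (0, v))
  refine ⟨((τ : _ →* _).comp g).toHomUnits, fun x y hxy => hg (τ.injective ?_)⟩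
  exact congrArg Units.val hxy

theorem padicValNat_two_seven_pow_odd_sub_one (m : ℕ) : padicValNat 2 (7 ^ (2 * m + 1) - 1) = 1 := by
  have h : 7 ^ (2 * m + 1) % 4 = 3 := by
    rw [pow_succ, pow_mul, Nat.mul_mod, Nat.pow_mod]
    simp
  have h1 : 7 ^ (2 * m + 1) - 1 = 2 * ((7 ^ (2 * m + 1) - 1) / 2) := by lia
  have h2 : ¬ 2 ∣ (7 ^ (2 * m + 1) - 1) / 2 := by lia
  rw [h1, padicValNat.mul two_ne_zero (by lia), padicValNat.self one_lt_two,
    padicValNat.eq_zero_of_not_dvd h2]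

theorem padicValNat_two_seven_pow_even_sub_one {m : ℕ} (hm : m ≠ 0) :
    padicValNat 2 (7 ^ (2 * m) - 1) = 4 + padicValNat 2 m := by
  have h := padicValNat.pow_two_sub_one (x := 7) (n := 2 * m) (by norm_num) (by norm_num)
    (by lia) (by simp)
  have h8 : padicValNat 2 (7 + 1) = 3 := padicValNat.prime_pow (p := 2) 3
  have h6 : padicValNat 2 (7 - 1) = 1 := by
    simpa using padicValNat_two_seven_pow_odd_sub_one 0
  rw [h8, h6, padicValNat.mul two_ne_zero hm, padicValNat.self one_lt_two] at h
  lia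

theorem padicValNat_two_prod_seven_pow_sub_one (m : ℕ) :
    padicValNat 2 (∏ i ∈ Finset.range (2 * m), (7 ^ (i + 1) - 1)) =
      5 * m + padicValNat 2 m.factorial := by
  have hne : ∀ k, 7 ^ (k + 1) - 1 ≠ 0 := fun k => by
    have := Nat.one_lt_pow k.succ_ne_zero (show 1 < 7 by norm_num)
    lia
  have hprod : ∀ k, ∏ i ∈ Finset.range k, (7 ^ (i + 1) - 1) ≠ 0 := fun k =>
    Finset.prod_ne_zero_iff.mpr fun i _ => hne i
  induction m with
  | zero => simp
  | succ m ih =>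
    rw [mul_add, mul_one, Finset.prod_range_succ, padicValNat.mul (hprod _) (hne _),
      Finset.prod_range_succ, padicValNat.mul (hprod _) (hne _), ih,
      padicValNat_two_seven_pow_odd_sub_one, show 2 * m + 1 + 1 = 2 * (m + 1) by ring,
      padicValNat_two_seven_pow_even_sub_one m.succ_ne_zero, Nat.factorial_succ,
      padicValNat.mul m.succ_ne_zero m.factorial_ne_zero]
    ring

theorem padicValNat_two_card_GL (F : Type*) [Field F] [Fintype F]
    (hF : Fintype.card F = 7) (m e : ℕ) (he : e < 2) :
    padicValNat 2 (Nat.card (GL (Fin (2 * m + e)) F)) = 5 * m + padicValNat 2 m.factorial + e := by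
  have hne : ∀ k, 7 ^ (k + 1) - 1 ≠ 0 := fun k => by
    have := Nat.one_lt_pow k.succ_ne_zero (show 1 < 7 by norm_num)
    lia
  have hprod : ∀ k, ∏ i ∈ Finset.range k, (7 ^ (i + 1) - 1) ≠ 0 := fun k =>
    Finset.prod_ne_zero_iff.mpr fun i _ => hne i
  have hcard : ∀ n, Nat.card (GL (Fin n) F) =
      (∏ i ∈ Finset.range n, 7 ^ i) * ∏ i ∈ Finset.range n, (7 ^ (i + 1) - 1) := by
    intro n
    rw [Matrix.card_GL_field, hF, Fin.prod_univ_eq_prod_range (fun i => 7 ^ n - 7 ^ i) n,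
      ← Finset.prod_range_reflect (fun i => 7 ^ (i + 1) - 1), ← Finset.prod_mul_distrib]
    refine Finset.prod_congr rfl fun i hi => ?_
    have hi := Finset.mem_range.mp hi
    rw [Nat.mul_sub, mul_one, ← pow_add]
    congr 2
    lia
  have hodd : ∀ n, padicValNat 2 (∏ i ∈ Finset.range n, 7 ^ i) = 0 := by
    intro n
    refine padicValNat.eq_zero_of_not_dvd ?_
    rw [Finset.prod_pow_eq_pow_sum]
    exact fun h => absurd (Nat.prime_two.dvd_of_dvd_pow h) (by norm_num)
  rw [hcard, padicValNat.mul (by simp [Finset.prod_ne_zero_iff]) (hprod _), hodd, zero_add]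
  interval_cases e
  · exact padicValNat_two_prod_seven_pow_sub_one m
  · rw [Finset.prod_range_succ, padicValNat.mul (hprod _) (hne _),
      padicValNat_two_prod_seven_pow_sub_one, padicValNat_two_seven_pow_odd_sub_one]

theorem not_two_dvd_index_blockMonomial (F : Type*) [Field F] [Fintype F]
    (hF : Fintype.card F = 7) {m e : ℕ} (he : e < 2)
    (f : BlockMonomial m e →* GL (Fin (2 * m + e)) F) (hf : Function.Injective f) :
    ¬ 2 ∣ f.range.index := by
  have h := congrArg (padicValNat 2) f.range.card_mul_index
  have hW : Nat.card f.range = 2 ^ (5 * m + e) * m.factorial := by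
    rw [← Nat.card_congr (MonoidHom.ofInjective hf).toEquiv, card_blockMonomial, pow_add, pow_mul]
    ring
  have hi : f.range.index ≠ 0 := Subgroup.index_ne_zero_of_finite
  rw [padicValNat_two_card_GL F hF m e he, hW, padicValNat.mul (by positivity) hi,
    padicValNat.mul (by positivity) (by positivity), padicValNat.prime_pow] at h
  intro h2
  have := one_le_padicValNat_of_dvd hi h2
  lia

theorem two_pow_mul_ten_pow_lt {m e : ℕ} (he : e < 2) (h : 2 < 2 * m + e) :
    2 ^ (m - 1) * 10 ^ m * 2 ^ e < ∑ i ∈ Finset.range (2 * m + e), 7 ^ i := by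
  obtain ⟨k, rfl⟩ : ∃ k, m = k + 1 := ⟨m - 1, by lia⟩
  rw [Nat.add_sub_cancel]
  have hgeom : ∀ n, 6 * ∑ i ∈ Finset.range n, 7 ^ i + 1 = 7 ^ n := by
    intro n
    induction n with
    | zero => simp
    | succ n ih => rw [Finset.sum_range_succ, pow_succ]; lia
  have hn := hgeom (2 * (k + 1) + e)
  have h20 : 2 ^ k * 10 ^ (k + 1) = 10 * 20 ^ k := by
    rw [pow_succ, show (20 : ℕ) = 2 * 10 by norm_num, mul_pow]; ring
  have h49 : 7 ^ (2 * (k + 1) + e) = 49 * 49 ^ k * 7 ^ e := by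
    rw [pow_add, pow_mul, pow_succ]; ring
  have hle : 20 ^ k ≤ 49 ^ k := Nat.pow_le_pow_left (by norm_num) k
  have hpos : 0 < 20 ^ k := by positivity
  rw [h20]
  rw [h49] at hn
  interval_cases e
  · obtain ⟨l, rfl⟩ : ∃ l, k = l + 1 := ⟨k - 1, by lia⟩
    have hle : 20 ^ l ≤ 49 ^ l := Nat.pow_le_pow_left (by norm_num) l
    have hpos : 0 < 20 ^ l := by positivity
    rw [pow_succ] at *
    lia
  · lia

/-- Let `F` be a finite field with `|F| = 7` and let `n > 2`.  Then every
`2`-subgroup `P` of `GL_n(F)` contains fewer than `7^{n-1} + ⋯ + 7 + 1` involutions. -/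
theorem card_involutions_two_subgroup_GLn_7_lt (F : Type*) [Field F] [Fintype F]
    (hF : Fintype.card F = 7) (n : ℕ) (hn : 2 < n)
    (P : Subgroup (GL (Fin n) F)) (hP : IsPGroup 2 P) :
    Nat.card {x : GL (Fin n) F | x ∈ P ∧ x ≠ 1 ∧ x ^ 2 = 1} <
      ∑ i ∈ Finset.range n, 7 ^ i := by
  obtain ⟨m, e, he, rfl⟩ : ∃ m e, e < 2 ∧ n = 2 * m + e :=
    ⟨n / 2, n % 2, Nat.mod_lt _ two_pos, (Nat.div_add_mod n 2).symm⟩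
  obtain ⟨f, hf⟩ := exists_blockMonomial_embedding F hF m e
  have hQ : ∀ Q : Subgroup (BlockMonomial m e), IsPGroup 2 Q →
      Nat.card {x : BlockMonomial m e | x ∈ Q ∧ x ^ 2 = 1} ≤ 2 ^ (m - 1) * 10 ^ m * 2 ^ e := by
    intro Q hQ
    refine (card_sq_eq_one_prod_le Q).trans (Nat.mul_le_mul ?_ (by simp))
    exact card_sq_eq_one_permWreath_le (by rw [card_signedOrthogonal]; norm_num)
      card_sq_eq_one_signedOrthogonal_le (by lia) _ (hQ.map _)
  have hle := card_sq_eq_one_le_of_odd_index f hf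
    (not_two_dvd_index_blockMonomial F hF he f hf) hQ P hP
  refine lt_of_le_of_lt (le_trans ?_ hle) (two_pow_mul_ten_pow_lt he hn)
  exact Nat.card_mono (Set.toFinite _) fun x hx => ⟨hx.1, hx.2.2⟩
end

section
/- Let p be a prime with p ≥ 7 and p ≡ 1 (mod 3), let q = p^a, and let F be a finite field with |F| = q. Suppose q ≡ 1 (mod 4) and n ≥ 2. Then every 2-subgroup P of GL_n(F) contains fewer than q^{n-1} + q^{n-2} + ⋯ + q + 1 involutions. -/
open Equiv

/-- Lifting the exponent at `2`, for a base congruent to `1` modulo `4`. -/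
theorem padicValNat_two_pow_sub_one {q : ℕ} (hq : 1 < q) (hq4 : q % 4 = 1) {j : ℕ} (hj : j ≠ 0) :
    padicValNat 2 (q ^ j - 1) = padicValNat 2 (q - 1) + padicValNat 2 j := by
  have hpow : 1 < q ^ j := Nat.one_lt_pow hj hq
  have h := Int.two_pow_sub_pow' (x := q) (y := 1) j (by omega) (by omega)
  have e1 : ((q : ℤ) ^ j - 1 ^ j) = ((q ^ j - 1 : ℕ) : ℤ) := by
    rw [Nat.cast_sub hpow.le]; simp
  have e2 : ((q : ℤ) - 1) = ((q - 1 : ℕ) : ℤ) := by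
    rw [Nat.cast_sub hq.le]; simp
  rw [e1, e2, show (2 : ℤ) = ((2 : ℕ) : ℤ) from rfl, Int.natCast_emultiplicity,
    Int.natCast_emultiplicity, Int.natCast_emultiplicity,
    ← padicValNat_eq_emultiplicity (by omega), ← padicValNat_eq_emultiplicity (by omega),
    ← padicValNat_eq_emultiplicity hj] at h
  exact_mod_cast h

/-- The orders of `GL_n` over a field with `q` elements and of its monomial subgroup have the same
`2`-part when `q ≡ 1 (mod 4)`. -/
theorem padicValNat_two_prod_pow_sub_pow {q : ℕ} (hq : 1 < q) (hq4 : q % 4 = 1) (n : ℕ) :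
    padicValNat 2 (∏ i : Fin n, (q ^ n - q ^ (i : ℕ))) =
      padicValNat 2 ((q - 1) ^ n * n.factorial) := by
  rw [Fin.prod_univ_eq_prod_range (fun i => q ^ n - q ^ i) n]
  induction n with
  | zero => simp
  | succ n ih =>
    have hpow : 1 < q ^ (n + 1) := Nat.one_lt_pow (by omega) hq
    have hprod : ∏ i ∈ Finset.range n, (q ^ n - q ^ i) ≠ 0 := by
      refine Finset.prod_ne_zero_iff.2 fun i hi => ?_
      have := Nat.pow_lt_pow_right hq (Finset.mem_range.1 hi)
      omega
    have hodd : padicValNat 2 (q ^ n) = 0 :=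
      padicValNat.eq_zero_of_not_dvd fun h => by
        have := Nat.prime_two.dvd_of_dvd_pow h
        omega
    have hstep : ∏ i ∈ Finset.range (n + 1), (q ^ (n + 1) - q ^ i) =
        q ^ n * (∏ i ∈ Finset.range n, (q ^ n - q ^ i)) * (q ^ (n + 1) - 1) := by
      rw [Finset.prod_range_succ', pow_zero]
      congr 1
      have : ∀ i ∈ Finset.range n, q ^ (n + 1) - q ^ (i + 1) = q * (q ^ n - q ^ i) := by
        intro i _
        rw [Nat.mul_sub, pow_succ', pow_succ']
      rw [Finset.prod_congr rfl this, Finset.prod_mul_distrib]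
      simp
    have hq0 : q ^ n ≠ 0 := by positivity
    have hq1 : q - 1 ≠ 0 := by omega
    rw [hstep, padicValNat.mul (by positivity) (by omega), padicValNat.mul hq0 hprod, hodd, ih,
      padicValNat_two_pow_sub_one hq hq4 n.succ_ne_zero, Nat.factorial_succ,
      padicValNat.mul (by positivity) (by positivity),
      padicValNat.mul (by positivity) (by positivity),
      padicValNat.mul (by positivity) (by positivity), pow_succ,
      padicValNat.mul (by positivity) (by positivity)]
    simp only [Nat.succ_eq_add_one]
    omega

/-- A `2`-group of permutations of `n ≥ 1` points has order at most `2 ^ (n - 1)`. -/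
theorem IsPGroup.card_perm_le {n : ℕ} (hn : n ≠ 0) {T : Subgroup (Perm (Fin n))}
    (hT : IsPGroup 2 T) : Nat.card T ≤ 2 ^ (n - 1) := by
  obtain ⟨k, hk⟩ := IsPGroup.iff_card.1 hT
  have hdvd : 2 ^ k ∣ n.factorial := by
    have := T.card_subgroup_dvd_card
    rwa [hk, Nat.card_perm, Nat.card_fin] at this
  have hle := (padicValNat_dvd_iff_le n.factorial_ne_zero).1 hdvd
  have hlt := padicValNat_factorial_lt_of_ne_zero 2 hn
  rw [hk]
  exact Nat.pow_le_pow_right two_pos (by omega)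

/-- The group of monomial matrices of size `n` over `F`, as an abstract semidirect product. -/
abbrev MonomialGroup (n : ℕ) (F : Type*) [Field F] : Type _ :=
  (Fin n → Fˣ) ⋊[mulAutArrow] Perm (Fin n)

namespace MonomialGroup

variable {n : ℕ} {F : Type*} [Field F]

theorem mul_left_apply (x y : MonomialGroup n F) (i : Fin n) :
    (x * y).left i = x.left i * y.left (x.right⁻¹ i) := rfl

/-- The monomial matrix attached to an element of the monomial group. -/
def toMatrix : MonomialGroup n F →* Matrix (Fin n) (Fin n) F where
  toFun x := Matrix.of fun i j => if i = x.right j then (x.left i : F) else 0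
  map_one' := by
    ext i j
    by_cases h : i = j <;> simp [Matrix.one_apply, h]
  map_mul' x y := by
    ext i k
    rw [Matrix.mul_apply, Finset.sum_eq_single (x.right⁻¹ i)]
    · by_cases h : i = x.right (y.right k) <;>
        simp [mul_left_apply, h, Equiv.symm_apply_eq]
    · intro j _ hj
      have : i ≠ x.right j := fun h => hj (by simp [h])
      simp [this]
    · simp

theorem toMatrix_apply (x : MonomialGroup n F) (i j : Fin n) :
    toMatrix x i j = if i = x.right j then (x.left i : F) else 0 := rfl

/-- The embedding of the monomial group into the general linear group. -/
def toGL : MonomialGroup n F →* GL (Fin n) F := toMatrix.toHomUnits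

theorem toGL_injective : Function.Injective (toGL (n := n) (F := F)) := by
  intro x y h
  have hxy : toMatrix x = toMatrix y := congrArg Units.val h
  have hright : x.right = y.right := by
    ext1 j
    have := congrFun (congrFun hxy (x.right j)) j
    by_contra hne
    simp [toMatrix_apply, hne] at this
  refine SemidirectProduct.ext (funext fun i => ?_) hright
  have := congrFun (congrFun hxy i) (x.right⁻¹ i)
  exact Units.ext (by simpa [toMatrix_apply, ← hright] using this)

theorem not_two_dvd_index_range_toGL [Fintype F] (h4 : Fintype.card F % 4 = 1) :
    ¬ 2 ∣ (toGL (n := n) (F := F)).range.index := by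
  have hq : 1 < Fintype.card F := Fintype.one_lt_card
  have hcard : Nat.card (toGL (n := n) (F := F)).range =
      (Fintype.card F - 1) ^ n * n.factorial := by
    rw [← Nat.card_congr (MonoidHom.ofInjective toGL_injective).toEquiv, SemidirectProduct.card,
      Nat.card_perm, Nat.card_fin, Nat.card_fun, Nat.card_fin, Nat.card_units,
      Nat.card_eq_fintype_card]
  have hmul := (toGL (n := n) (F := F)).range.index_mul_card
  have hindex : (toGL (n := n) (F := F)).range.index ≠ 0 := Subgroup.index_ne_zero_of_finite
  have hval := padicValNat_two_prod_pow_sub_pow hq h4 n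
  have hq1 : Fintype.card F - 1 ≠ 0 := by omega
  rw [← Matrix.card_GL_field, ← hmul, hcard, padicValNat.mul hindex (by positivity)] at hval
  intro hdvd
  have := (dvd_iff_padicValNat_ne_zero hindex).1 hdvd
  omega

end MonomialGroup

/-- A `p`-subgroup has a conjugate inside any subgroup whose index is prime to `p`. -/
theorem IsPGroup.exists_conj_mem {p : ℕ} [Fact p.Prime] {G : Type*} [Group G] {P : Subgroup G}
    (hP : IsPGroup p P) {H : Subgroup G} (hH : ¬ p ∣ H.index) :
    ∃ g : G, ∀ x ∈ P, g⁻¹ * x * g ∈ H := by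
  obtain ⟨c, hc⟩ := hP.nonempty_fixed_point_of_prime_not_dvd_card (G ⧸ H) hH
  obtain ⟨g, rfl⟩ := QuotientGroup.mk_surjective c
  refine ⟨g, fun x hx => ?_⟩
  have h : ((x * g : G) : G ⧸ H) = g := hc ⟨x, hx⟩
  have := H.inv_mem (QuotientGroup.eq.1 h)
  simpa [mul_assoc] using this

/-- The tuples of `2`-power roots of unity inverted by an involutive permutation `σ` number at most
`s ^ (n / 2)`, where `s` is the number of all `2`-power roots of unity. -/
theorem card_inverted_tuples_sq_le {n : ℕ} {F : Type*} [Field F] [Fintype F]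
    (h4 : Fintype.card F % 4 = 1) {σ : Perm (Fin n)}
    (hσ : ∀ i, σ (σ i) = i) :
    Nat.card {e : Fin n → CommGroup.primaryComponent Fˣ 2 // ∀ i, e i * e (σ i) = 1} ^ 2 ≤
      Nat.card (CommGroup.primaryComponent Fˣ 2) ^ n := by
  set S := CommGroup.primaryComponent Fˣ 2
  have hneg : (-1 : F) ≠ 1 := by
    refine Ring.neg_one_ne_one_of_char_ne_two fun h => ?_
    have := FiniteField.even_card_of_char_two h
    omega
  obtain ⟨z, hz⟩ : ∃ z : Fˣ, z ^ 2 = -1 := by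
    obtain ⟨z, hz⟩ := FiniteField.isSquare_neg_one_iff (F := F) |>.2 (by omega)
    have hz0 : z ≠ 0 := by rintro rfl; simp at hz
    exact ⟨Units.mk0 z hz0, by ext; simp [hz, sq]⟩
  let ζ : S := ⟨z, 2, by rw [show 2 ^ 2 = 2 * 2 from rfl, pow_mul, hz]; simp⟩
  have hζ : ζ ^ 2 ≠ 1 := fun h => hneg <| by
    have : z ^ 2 = 1 := congrArg Subtype.val h
    rw [hz] at this
    simpa using congrArg Units.val this
  have hroot : ∀ u v : S, u * u = 1 → v * v = 1 → u ≠ 1 → v ≠ 1 → u = v := by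
    have key : ∀ u : S, u * u = 1 → u ≠ 1 → ((u : Fˣ) : F) = -1 := by
      intro u hu hu1
      have h : ((u : Fˣ) : F) * ((u : Fˣ) : F) = 1 := by
        simpa using congrArg (fun w : S => ((w : Fˣ) : F)) hu
      refine (mul_self_eq_one_iff.1 h).resolve_left fun h1 => hu1 ?_
      exact Subtype.ext (Units.ext h1)
    intro u v hu hv hu1 hv1
    exact Subtype.ext (Units.ext ((key u hu hu1).trans (key v hv hv1).symm))
  let A := {e : Fin n → S // ∀ i, e i * e (σ i) = 1}
  classical
  -- A fixed point carries two signs, encoded by a fourth root of unity; a transposition carries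
  -- one root of unity for each of the two tuples.
  let f : A × A → (Fin n → S) := fun x i =>
    if σ i = i then (if x.2.1 i = 1 then x.1.1 i else ζ * x.1.1 i)
    else if i < σ i then x.1.1 i else x.2.1 i
  have hback : ∀ e e' : A, ∀ i, e.1 (σ i) = e'.1 (σ i) → e.1 i = e'.1 i := fun e e' i h => by
    rw [eq_inv_of_mul_eq_one_left (e.2 i), eq_inv_of_mul_eq_one_left (e'.2 i), h]
  have hf : Function.Injective f := by
    intro x y hxy
    have hcoord : ∀ i, x.1.1 i = y.1.1 i ∧ x.2.1 i = y.2.1 i := by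
      intro i
      have hi : f x i = f y i := congrFun hxy i
      by_cases hfix : σ i = i
      · have hsq : ∀ e : A, e.1 i * e.1 i = 1 := fun e => by simpa [hfix] using e.2 i
        have hne : ∀ e e' : A, e.1 i ≠ ζ * e'.1 i := fun e e' h => hζ <| by
          have h2 := hsq e
          rw [h, mul_mul_mul_comm, hsq e', mul_one] at h2
          rw [sq, h2]
        simp only [f, if_pos hfix] at hi
        split_ifs at hi with h1 h2 h2
        · exact ⟨hi, h1.trans h2.symm⟩
        · exact absurd hi (hne _ _)
        · exact absurd hi.symm (hne _ _)
        · exact ⟨mul_left_cancel hi, hroot _ _ (hsq _) (hsq _) h1 h2⟩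
      · have hi' : f x (σ i) = f y (σ i) := congrFun hxy (σ i)
        have hfix' : σ (σ i) ≠ σ i := fun h => hfix (σ.injective h)
        simp only [f, if_neg hfix, if_neg hfix', hσ i] at hi hi'
        rcases lt_or_gt_of_ne hfix with hlt | hlt
        · rw [if_neg hlt.not_gt, if_neg hlt.not_gt] at hi
          rw [if_pos hlt, if_pos hlt] at hi'
          exact ⟨hback _ _ _ hi', hi⟩
        · rw [if_pos hlt, if_pos hlt] at hi
          rw [if_neg hlt.not_gt, if_neg hlt.not_gt] at hi'
          exact ⟨hi, hback _ _ _ hi'⟩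
    exact Prod.ext (Subtype.ext (funext fun i => (hcoord i).1))
      (Subtype.ext (funext fun i => (hcoord i).2))
  have := Nat.card_le_card_of_injective f hf
  rwa [Nat.card_prod, ← sq, Nat.card_fun, Nat.card_fin] at this

namespace MonomialGroup

variable {n : ℕ} {F : Type*} [Field F] [Fintype F]

/-- Over a given permutation, a `2`-subgroup of the monomial group has at most `s ^ (n / 2)`
elements of square `1`, where `s` is the number of `2`-power roots of unity. -/
theorem card_sq_eq_one_over_sq_le (h4 : Fintype.card F % 4 = 1)
    {Q : Subgroup (MonomialGroup n F)} (hQ : IsPGroup 2 Q) (σ : Perm (Fin n)) :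
    Nat.card {x : MonomialGroup n F // (x ∈ Q ∧ x ^ 2 = 1) ∧ x.right = σ} ^ 2 ≤
      Nat.card (CommGroup.primaryComponent Fˣ 2) ^ n := by
  rcases isEmpty_or_nonempty
    {x : MonomialGroup n F // (x ∈ Q ∧ x ^ 2 = 1) ∧ x.right = σ} with hemp | ⟨⟨y, ⟨hyQ, hy⟩, hyσ⟩⟩
  · simp
  have hσ2 : σ * σ = 1 := by
    rw [← hyσ, ← SemidirectProduct.mul_right, ← sq, hy, SemidirectProduct.one_right]
  have hσinv : σ⁻¹ = σ := inv_eq_of_mul_eq_one_left hσ2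
  have hσ : ∀ i, σ (σ i) = i := fun i => congrArg (fun τ : Perm (Fin n) => τ i) hσ2
  have hinv : ∀ x : MonomialGroup n F, x ^ 2 = 1 → x.right = σ →
      ∀ i, x.left i * x.left (σ i) = 1 := by
    intro x hx hxσ i
    have h := mul_left_apply x x i
    rw [← sq, hx, hxσ, hσinv] at h
    exact h.symm
  have hquot : ∀ x ∈ Q, x.right = σ →
      ∀ i, x.left i / y.left i ∈ CommGroup.primaryComponent Fˣ 2 := by
    intro x hx hxσ i
    obtain ⟨k, hk⟩ := hQ ⟨x * y⁻¹, Q.mul_mem hx (Q.inv_mem hyQ)⟩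
    have hk' : (x * y⁻¹) ^ 2 ^ k = 1 := congrArg Subtype.val hk
    have heq : x * y⁻¹ = SemidirectProduct.inl (x.left / y.left) := by
      rw [mul_inv_eq_iff_eq_mul]
      refine SemidirectProduct.ext ?_ ?_
      · ext1 j
        rw [mul_left_apply, SemidirectProduct.left_inl, SemidirectProduct.right_inl]
        simp
      · rw [SemidirectProduct.mul_right, SemidirectProduct.right_inl, one_mul, hxσ, hyσ]
    rw [heq, ← map_pow] at hk'
    have := SemidirectProduct.inl_injective (hk'.trans (map_one _).symm)
    exact ⟨k, congrFun this i⟩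
  refine le_trans (Nat.pow_le_pow_left ?_ 2) (card_inverted_tuples_sq_le h4 hσ)
  let f : {x : MonomialGroup n F // (x ∈ Q ∧ x ^ 2 = 1) ∧ x.right = σ} →
      {e : Fin n → CommGroup.primaryComponent Fˣ 2 // ∀ i, e i * e (σ i) = 1} := fun x =>
    ⟨fun i => ⟨x.1.left i / y.left i, hquot x.1 x.2.1.1 x.2.2 i⟩, fun i => Subtype.ext <| by
      change x.1.left i / y.left i * (x.1.left (σ i) / y.left (σ i)) = 1
      rw [div_mul_div_comm, hinv x.1 x.2.1.2 x.2.2 i, hinv y hy hyσ i, div_one]⟩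
  refine Nat.card_le_card_of_injective f fun x x' h => Subtype.ext ?_
  refine SemidirectProduct.ext (funext fun i => ?_) (x.2.2.trans x'.2.2.symm)
  have := congrArg Subtype.val (congrFun (congrArg Subtype.val h) i)
  exact div_left_injective this

theorem card_sq_eq_one_le (hn : n ≠ 0) (h4 : Fintype.card F % 4 = 1)
    {Q : Subgroup (MonomialGroup n F)} (hQ : IsPGroup 2 Q) :
    Nat.card {x : MonomialGroup n F // x ∈ Q ∧ x ^ 2 = 1} ≤
      2 ^ (n - 1) * Nat.sqrt (Nat.card (CommGroup.primaryComponent Fˣ 2) ^ n) := by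
  classical
  have : Finite (MonomialGroup n F) := .of_equiv _ SemidirectProduct.equivProd.symm
  let T := Q.map SemidirectProduct.rightHom
  have hT : Nat.card T ≤ 2 ^ (n - 1) := IsPGroup.card_perm_le hn (hQ.map _)
  let r : {x : MonomialGroup n F // x ∈ Q ∧ x ^ 2 = 1} → T :=
    fun x => ⟨x.1.right, x.1, x.2.1, rfl⟩
  have hfiber : ∀ t : T, Nat.card {x // r x = t} ≤
      Nat.sqrt (Nat.card (CommGroup.primaryComponent Fˣ 2) ^ n) := by
    intro t
    rw [Nat.le_sqrt']
    refine le_trans (Nat.pow_le_pow_left ?_ 2) (card_sq_eq_one_over_sq_le h4 hQ t.1)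
    refine Nat.card_le_card_of_injective
      (fun x => ⟨x.1.1, x.1.2, congrArg Subtype.val x.2⟩) fun x x' h => ?_
    have hval : x.1.1 = x'.1.1 := Subtype.mk.inj h
    exact Subtype.ext (Subtype.ext hval)
  have := Fintype.ofFinite T
  rw [← Nat.card_congr (Equiv.sigmaFiberEquiv r), Nat.card_sigma]
  refine (Finset.sum_le_card_nsmul _ _ _ fun t _ => hfiber t).trans ?_
  rw [smul_eq_mul, Finset.card_univ, ← Nat.card_eq_fintype_card]
  exact Nat.mul_le_mul_right _ hT

end MonomialGroup

/-- If `3` divides `|F| - 1`, the `2`-power roots of unity make up at most half of `Fˣ`. -/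
theorem two_mul_card_primaryComponent_le {F : Type*} [Field F] [Fintype F]
    (h3 : Fintype.card F % 3 = 1) :
    2 * Nat.card (CommGroup.primaryComponent Fˣ 2) ≤ Fintype.card F := by
  have hq : 1 < Fintype.card F := Fintype.one_lt_card
  obtain ⟨k, hk⟩ := IsPGroup.iff_card.1 (CommGroup.primaryComponent.isPGroup (G := Fˣ) (p := 2))
  obtain ⟨m, hm⟩ := (CommGroup.primaryComponent Fˣ 2).card_subgroup_dvd_card
  rw [Nat.card_units, Nat.card_eq_fintype_card] at hm
  have hm1 : m ≠ 1 := by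
    rintro rfl
    have h : 3 ∣ 2 ^ k := by rw [← hk]; omega
    have := Nat.prime_three.dvd_of_dvd_pow h
    omega
  have hm0 : m ≠ 0 := by rintro rfl; omega
  have := Nat.mul_le_mul_left (Nat.card (CommGroup.primaryComponent Fˣ 2))
    (show 2 ≤ m by omega)
  omega

/-- Let `q = p^a` with `p` prime, `p ≥ 7`, `p ≡ 1 (mod 3)`, and let `F` be a
finite field of cardinality `q`.  If `q ≡ 1 (mod 4)` and `n ≥ 2`, then every `2`-subgroup `P`
of `GL_n(F)` contains fewer than `q^{n-1} + ⋯ + q + 1` involutions. -/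
theorem card_involutions_two_subgroup_GLn_lt (p a n q : ℕ) (hp : p.Prime) (hp7 : 7 ≤ p)
    (hp3 : p % 3 = 1) (hq : q = p ^ a) (F : Type*) [Field F] [Fintype F]
    (hF : Fintype.card F = q) (hq4 : q % 4 = 1) (hn : 2 ≤ n)
    (P : Subgroup (GL (Fin n) F)) (hP : IsPGroup 2 P) :
    Nat.card {x : GL (Fin n) F | x ∈ P ∧ x ≠ 1 ∧ x ^ 2 = 1} <
      ∑ i ∈ Finset.range n, q ^ i := by
  have hq3 : Fintype.card F % 3 = 1 := by
    rw [hF, hq, Nat.pow_mod, hp3]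
    simp
  have hq1 : 1 < q := hF ▸ Fintype.one_lt_card
  have hcard4 : Fintype.card F % 4 = 1 := hF ▸ hq4
  obtain ⟨g, hg⟩ := hP.exists_conj_mem
    (MonomialGroup.not_two_dvd_index_range_toGL (n := n) hcard4)
  let c : GL (Fin n) F ≃* GL (Fin n) F := MulAut.conj g
  let Q : Subgroup (MonomialGroup n F) := (P.comap c.toMonoidHom).comap MonomialGroup.toGL
  have hQ : IsPGroup 2 Q :=
    (hP.comap_of_injective _ c.injective).comap_of_injective _ MonomialGroup.toGL_injective
  choose lift hlift using hg
  have hconj : ∀ x (hx : x ∈ P), c (MonomialGroup.toGL (lift x hx)) = x := by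
    intro x hx
    simp [hlift, c, MulAut.conj_apply, mul_assoc]
  have hle : Nat.card {x : GL (Fin n) F | x ∈ P ∧ x ≠ 1 ∧ x ^ 2 = 1} ≤
      Nat.card {x : MonomialGroup n F // x ∈ Q ∧ x ^ 2 = 1} := by
    have : Finite (MonomialGroup n F) := .of_equiv _ SemidirectProduct.equivProd.symm
    refine Nat.card_le_card_of_injective (fun x => ⟨lift x.1 x.2.1, ?_, ?_⟩) ?_
    · change c (MonomialGroup.toGL (lift x.1 x.2.1)) ∈ P
      rw [hconj]
      exact x.2.1
    · apply MonomialGroup.toGL_injective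
      apply c.injective
      rw [map_pow, map_pow, hconj, x.2.2.2, map_one, map_one]
    · intro x y h
      refine Subtype.ext ?_
      rw [← hconj x.1 x.2.1, ← hconj y.1 y.2.1]
      exact congrArg (fun z => c (MonomialGroup.toGL z)) (congrArg Subtype.val h)
  refine (hle.trans (MonomialGroup.card_sq_eq_one_le (by omega) hcard4 hQ)).trans_lt ?_
  have hs := two_mul_card_primaryComponent_le hq3
  rw [hF] at hs
  set s := Nat.card (CommGroup.primaryComponent Fˣ 2)
  obtain ⟨m, rfl⟩ : ∃ m, n = m + 2 := ⟨n - 2, by omega⟩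
  have hpow : 2 ^ (m + 1) * Nat.sqrt (s ^ (m + 2)) ≤ q ^ (m + 1) := by
    refine (Nat.pow_le_pow_iff_left two_ne_zero).1 ?_
    calc (2 ^ (m + 1) * Nat.sqrt (s ^ (m + 2))) ^ 2
        = (2 ^ (m + 1)) ^ 2 * Nat.sqrt (s ^ (m + 2)) ^ 2 := mul_pow _ _ _
      _ ≤ (2 ^ (m + 1)) ^ 2 * s ^ (m + 2) := Nat.mul_le_mul_left _ (Nat.sqrt_le' _)
      _ = 2 ^ m * (2 * s) ^ (m + 2) := by ring
      _ ≤ q ^ m * q ^ (m + 2) :=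
        Nat.mul_le_mul (Nat.pow_le_pow_left hq1 m) (Nat.pow_le_pow_left hs _)
      _ = (q ^ (m + 1)) ^ 2 := by ring
  rw [Finset.sum_range_succ, Finset.sum_range_succ', pow_zero]
  have : m + 2 - 1 = m + 1 := rfl
  rw [this]
  omega
end
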